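/- Invariance of domain: if U is an open subset of ℝⁿ and f : U → ℝⁿ is continuous and injective, then f(U) is open in ℝⁿ and f is a homeomorphism onto its image. -/

import Mathlib

open Set Metric MeasureTheory Topology

section
variable {E : Type*} [NormedAddCommGroup E] [NormedSpace ℝ E] [FiniteDimensional ℝ E]

theorem exists_det_one_add_interpolation (S : Finset ℝ) (hS : S.card = Module.finrank ℝ E + 1) :
    ∃ w : ℝ → ℝ, ∑ s ∈ S, w s = 1 ∧
      ∀ A : E →L[ℝ] E, (1 + A).det = ∑ s ∈ S, w s * (1 + s • A).det := by
  classical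
  have hne : S.Nonempty := by rw [← Finset.card_pos]; omega
  refine ⟨fun s ↦ (Lagrange.basis S id s).eval 1, ?_, fun A ↦ ?_⟩
  · rw [← Polynomial.eval_finsetSum, Lagrange.sum_basis Function.injective_id.injOn hne,
      Polynomial.eval_one]
  · set b := Module.finBasis ℝ E
    set M := LinearMap.toMatrix b b (A : E →ₗ[ℝ] E) with hM
    set p : Polynomial ℝ :=
      (Matrix.det ((Polynomial.X : Polynomial ℝ) • M.map Polynomial.C +
        (1 : Matrix _ _ ℝ).map Polynomial.C)) with hp
    have hdeg : p.degree < S.card := by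
      refine (Polynomial.degree_le_natDegree).trans_lt ?_
      have := Polynomial.natDegree_det_X_add_C_le M 1
      rw [Fintype.card_fin] at this
      rw [hS]
      exact_mod_cast Nat.lt_succ_of_le this
    have hev (t : ℝ) : p.eval t = (1 + t • A).det := by
      have h : ((1 + t • A : E →L[ℝ] E) : E →ₗ[ℝ] E) = 1 + t • (A : E →ₗ[ℝ] E) := rfl
      rw [ContinuousLinearMap.det, h, ← LinearMap.det_toMatrix b, map_add, map_smul, ← hM,
        LinearMap.toMatrix_one, hp, ← Polynomial.coe_evalRingHom, RingHom.map_det]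
      congr 1
      ext i j
      simpa [Matrix.one_apply, add_comm, apply_ite] using mul_comm _ _
    have h := congrArg (Polynomial.eval 1)
      (Lagrange.eq_interpolate (v := id) Function.injective_id.injOn hdeg)
    rw [hev, one_smul, Lagrange.interpolate_apply, Polynomial.eval_finsetSum] at h
    rw [h]
    refine Finset.sum_congr rfl fun s _ ↦ ?_
    rw [Polynomial.eval_mul, Polynomial.eval_C, id, hev, mul_comm]

theorem det_one_add_pos_of_norm_lt_one {A : E →L[ℝ] E} (hA : ‖A‖ < 1) : 0 < (1 + A).det := by
  have hne : ∀ t ∈ Icc (0 : ℝ) 1, (1 + t • A).det ≠ 0 := by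
    intro t ht h0
    obtain ⟨v, hv, hv0⟩ := (Submodule.ne_bot_iff _).1 (LinearMap.bot_lt_ker_of_det_eq_zero h0).ne'
    have hv' : v = -(t • A v) := eq_neg_of_add_eq_zero_left hv
    have h1 : ‖v‖ ≤ ‖A‖ * ‖v‖ := by
      calc ‖v‖ = t * ‖A v‖ := by
            conv_lhs => rw [hv', norm_neg, norm_smul, Real.norm_of_nonneg ht.1]
        _ ≤ 1 * ‖A v‖ := by gcongr; exact ht.2
        _ ≤ ‖A‖ * ‖v‖ := by rw [one_mul]; exact A.le_opNorm v
    have := norm_pos_iff.2 hv0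
    nlinarith
  have hcont : ContinuousOn (fun t : ℝ ↦ (1 + t • A).det) (Icc 0 1) :=
    (ContinuousLinearMap.continuous_det.comp (by fun_prop)).continuousOn
  by_contra! h
  obtain ⟨t, ht, h0⟩ := intermediate_value_Icc' zero_le_one hcont
    (show (0 : ℝ) ∈ Icc _ _ by simpa [ContinuousLinearMap.det] using h)
  exact hne t ht h0

theorem bijective_add_smul_of_lipschitzWith {K : NNReal} {u : E → E} (hu : LipschitzWith K u)
    {t : ℝ} (ht : ‖t‖₊ * K < 1) : Function.Bijective fun x ↦ x + t • u x := by
  have hlip (y : E) : ContractingWith (‖t‖₊ * K) fun x ↦ y - t • u x := by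
    refine ⟨ht, LipschitzWith.of_dist_le_mul fun a b ↦ ?_⟩
    rw [dist_sub_left, dist_smul₀, NNReal.coe_mul, coe_nnnorm, mul_assoc]
    gcongr
    exact hu.dist_le_mul a b
  constructor
  · intro a b hab
    refine (hlip (a + t • u a)).fixedPoint_unique' ?_ ?_
    · simp [Function.IsFixedPt]
    · simp only at hab
      simp [Function.IsFixedPt, hab]
  · intro y
    obtain ⟨x, hx⟩ : ∃ x, Function.IsFixedPt (fun x ↦ y - t • u x) x :=
      ⟨_, (hlip y).fixedPoint_isFixedPt⟩
    exact ⟨x, (sub_eq_iff_eq_add.1 hx).symm⟩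

end

section
variable {E : Type*} [NormedAddCommGroup E] [NormedSpace ℝ E]

theorem LipschitzOnWith.indicator_ball {K : NNReal} {u : E → E} {R : ℝ}
    (hu : LipschitzOnWith K u (closedBall 0 R)) (h0 : ∀ x, ‖x‖ = R → u x = 0) :
    LipschitzWith K ((ball 0 R).indicator u) := by
  have key : ∀ x ∈ ball (0 : E) R, ∀ y ∉ ball (0 : E) R, ‖u x‖ ≤ K * ‖x - y‖ := by
    intro x hx y hy
    rw [mem_ball_zero_iff] at hx hy
    obtain ⟨z, hz, hzR⟩ := (convex_segment x y).isPreconnected.intermediate_value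
      (left_mem_segment ℝ x y) (right_mem_segment ℝ x y) continuous_norm.continuousOn
      (show R ∈ Icc _ _ from ⟨hx.le, not_lt.1 hy⟩)
    have h1 := hu.norm_sub_le (mem_closedBall_zero_iff.2 hx.le) (mem_closedBall_zero_iff.2 hzR.le)
    rw [h0 z hzR, sub_zero] at h1
    refine h1.trans ?_
    gcongr
    have := norm_sub_le_of_mem_segment hz
    rw [norm_sub_rev x z, norm_sub_rev x y]
    exact this
  refine LipschitzWith.of_dist_le_mul fun x y ↦ ?_
  rw [dist_eq_norm, dist_eq_norm]
  by_cases hx : x ∈ ball (0 : E) R <;> by_cases hy : y ∈ ball (0 : E) R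
  · simpa [hx, hy] using hu.norm_sub_le (ball_subset_closedBall hx) (ball_subset_closedBall hy)
  · simpa [hx, hy] using key x hx y hy
  · rw [norm_sub_rev x]
    simpa [hx, hy] using key y hy x hx
  · simp [hx, hy]; positivity
end

section
variable {E : Type*} [NormedAddCommGroup E] [InnerProductSpace ℝ E] [FiniteDimensional ℝ E]

theorem image_ball_add_smul_indicator {K : NNReal} {u : E → E}
    (hu : LipschitzWith K ((ball 0 1).indicator u)) {t : ℝ} (ht : ‖t‖₊ * K < 1) :
    InjOn (fun x ↦ x + t • u x) (ball 0 1) ∧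
      (fun x ↦ x + t • u x) '' ball 0 1 = ball (0 : E) 1 := by
  have hbij := bijective_add_smul_of_lipschitzWith hu ht
  have heq : EqOn (fun x ↦ x + t • (ball 0 1).indicator u x) (fun x ↦ x + t • u x)
      (ball 0 1) := fun x hx ↦ by simp only [indicator_of_mem hx]
  refine ⟨hbij.injective.injOn.congr heq, ?_⟩
  rw [← heq.image_eq, ← compl_inj_iff, ← image_compl_eq hbij]
  refine (image_congr fun x hx ↦ ?_).trans (image_id _)
  simp only [indicator_of_notMem hx, smul_zero, add_zero, id]

theorem setIntegral_det_one_add_smul_fderiv [MeasurableSpace E] [BorelSpace E] {K : NNReal}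
    {u : E → E} (hu : LipschitzWith K ((ball 0 1).indicator u)) (hd : Differentiable ℝ u)
    {t : ℝ} (ht : ‖t‖₊ * K < 1) :
    ∫ x in ball (0 : E) 1, (1 + t • fderiv ℝ u x).det = volume.real (ball (0 : E) 1) := by
  obtain ⟨hinj, himage⟩ := image_ball_add_smul_indicator hu ht
  have hderiv : ∀ x ∈ ball (0 : E) 1, HasFDerivWithinAt (fun x ↦ x + t • u x)
      (1 + t • fderiv ℝ u x) (ball 0 1) x := fun x _ ↦
    ((hasFDerivAt_id x).add ((hd x).hasFDerivAt.const_smul t)).hasFDerivWithinAt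
  have h := integral_image_eq_integral_abs_det_fderiv_smul volume measurableSet_ball hderiv hinj
    fun _ ↦ (1 : ℝ)
  rw [himage, setIntegral_const, smul_eq_mul, mul_one] at h
  rw [h]
  refine setIntegral_congr_fun measurableSet_ball fun x hx ↦ ?_
  have hlip : LipschitzOnWith K u (ball 0 1) := fun a ha b hb ↦ by
    simpa only [indicator_of_mem ha, indicator_of_mem hb] using hu a b
  have hnorm : ‖t • fderiv ℝ u x‖ < 1 := by
    refine lt_of_le_of_lt ?_ (show ‖t‖ * K < 1 from mod_cast ht)
    rw [norm_smul]
    gcongr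
    exact norm_fderiv_le_of_lipschitzOn ℝ (isOpen_ball.mem_nhds hx) hlip
  simp only [smul_eq_mul, mul_one, abs_of_pos (det_one_add_pos_of_norm_lt_one hnorm)]

theorem det_fderiv_eq_zero_of_norm_eventually_eq_one {r : E → E} {x : E}
    (hd : DifferentiableAt ℝ r x) (h : ∀ᶠ y in 𝓝 x, ‖r y‖ = 1) : (fderiv ℝ r x).det = 0 := by
  by_contra hdet
  have hconst : (fun y ↦ inner ℝ (r y) (r y)) =ᶠ[𝓝 x] fun _ ↦ (1 : ℝ) := by
    filter_upwards [h] with y hy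
    rw [real_inner_self_eq_norm_sq, hy, one_pow]
  have hsurj := (LinearMap.equivOfDetNeZero _ hdet).surjective
  obtain ⟨v, hv⟩ := hsurj (r x)
  have hv' : fderiv ℝ r x v = r x := hv
  have hderiv := (hd.hasFDerivAt.inner ℝ hd.hasFDerivAt).congr_of_eventuallyEq hconst.symm
  have h0 := congrArg (fun A : E →L[ℝ] ℝ ↦ A v) (hderiv.unique (hasFDerivAt_const 1 x))
  simp [hv', h.self_of_nhds] at h0

/-- There is no `C¹` retraction of the closed unit ball onto the unit sphere. -/
theorem not_exists_contDiff_retraction_sphere :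
    ¬ ∃ r : E → E, ContDiff ℝ 1 r ∧ (∀ x, ‖x‖ ≤ 1 → ‖r x‖ = 1) ∧ ∀ x, ‖x‖ = 1 → r x = x := by
  rintro ⟨r, hr, hr1, hrid⟩
  borelize E
  set u : E → E := fun x ↦ r x - x with hu_def
  have hu : ContDiff ℝ 1 u := hr.sub contDiff_id
  obtain ⟨K, hK⟩ := hu.contDiffOn.exists_lipschitzOnWith one_ne_zero
    (convex_closedBall (0 : E) 1) (isCompact_closedBall 0 1)
  have hlip := hK.indicator_ball fun x hx ↦ by simp [hu_def, hrid x hx]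
  obtain ⟨S, hS, hcard⟩ :=
    (Ioo_infinite (show (0 : ℝ) < 1 / (K + 1) by positivity)).exists_subset_card_eq
      (Module.finrank ℝ E + 1)
  obtain ⟨w, hw, hdet⟩ := exists_det_one_add_interpolation S hcard
  have hint (s : ℝ) : IntegrableOn (fun x ↦ (1 + s • fderiv ℝ u x).det) (ball 0 1) := by
    have hc : Continuous fun x ↦ (1 + s • fderiv ℝ u x).det :=
      ContinuousLinearMap.continuous_det.comp
        (continuous_const.add ((hu.continuous_fderiv one_ne_zero).const_smul s))
    exact (hc.continuousOn.integrableOn_compact (isCompact_closedBall 0 1)).mono_set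
      ball_subset_closedBall
  have hzero : ∫ x in ball (0 : E) 1, (1 + fderiv ℝ u x).det = 0 := by
    refine setIntegral_eq_zero_of_forall_eq_zero fun x hx ↦ ?_
    have hd := hr.differentiable one_ne_zero x
    have h1 : 1 + fderiv ℝ u x = fderiv ℝ r x := by
      rw [hu_def, fderiv_fun_sub hd differentiableAt_fun_id, fderiv_fun_id]
      exact add_sub_cancel _ _
    rw [h1]
    refine det_fderiv_eq_zero_of_norm_eventually_eq_one hd ?_
    filter_upwards [isOpen_ball.mem_nhds hx] with y hy
    exact hr1 y (mem_ball_zero_iff.1 hy).le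
  have hvol : ∫ x in ball (0 : E) 1, (1 + fderiv ℝ u x).det = volume.real (ball (0 : E) 1) := by
    rw [integral_congr_ae (.of_forall fun x ↦ hdet _),
      integral_finsetSum _ fun s _ ↦ (hint s).const_mul (w s)]
    calc _ = ∑ s ∈ S, w s * volume.real (ball (0 : E) 1) := by
          refine Finset.sum_congr rfl fun s hs ↦ ?_
          obtain ⟨hs0, hs1⟩ := hS hs
          rw [integral_const_mul, setIntegral_det_one_add_smul_fderiv hlip
            (hu.differentiable one_ne_zero)]
          rw [← NNReal.coe_lt_coe, NNReal.coe_mul, coe_nnnorm, Real.norm_of_nonneg hs0.le,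
            NNReal.coe_one]
          rw [lt_div_iff₀ (by positivity)] at hs1
          linarith
      _ = _ := by rw [← Finset.sum_mul, hw, one_mul]
  have hpos : 0 < volume.real (ball (0 : E) 1) :=
    ENNReal.toReal_pos (measure_ball_pos _ _ one_pos).ne' measure_ball_lt_top.ne
  linarith

/-- A `C¹` map that is uniformly close to the identity on the closed unit ball has a zero there. -/
theorem ContDiff.exists_zero_of_norm_sub_le {F : E → E} (hF : ContDiff ℝ 1 F)
    (h : ∀ x, ‖x‖ ≤ 1 → ‖F x - x‖ ≤ 1 / 2) : ∃ x, ‖x‖ ≤ 1 ∧ F x = 0 := by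
  by_contra! hne
  let χ : ContDiffBump (0 : E) := ⟨2 / 3, 1, by norm_num, by norm_num⟩
  set G : E → E := fun x ↦ x + χ x • (F x - x) with hG
  have hGc : ContDiff ℝ 1 G := contDiff_id.add (χ.contDiff.smul (hF.sub contDiff_id))
  have hGout : ∀ x, 1 ≤ ‖x‖ → G x = x := fun x hx ↦ by
    simp [hG, χ.zero_of_le_dist (x := x) (by simpa using hx)]
  have hG0 : ∀ x, G x ≠ 0 := by
    intro x
    rcases le_total ‖x‖ (2 / 3) with hx | hx
    · have : χ x = 1 := χ.one_of_mem_closedBall (mem_closedBall_zero_iff.2 hx)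
      simpa [hG, this] using hne x (hx.trans (by norm_num))
    rcases le_total 1 ‖x‖ with hx1 | hx1
    · rw [hGout x hx1, ← norm_pos_iff]
      linarith
    · intro h0
      have h1 : ‖x‖ = χ x * ‖F x - x‖ := by
        conv_lhs => rw [eq_neg_of_add_eq_zero_left h0, norm_neg, norm_smul,
          Real.norm_of_nonneg χ.nonneg]
      have h2 : χ x * ‖F x - x‖ ≤ 1 * (1 / 2) := by
        gcongr
        exacts [χ.le_one, h x hx1]
      linarith
  refine not_exists_contDiff_retraction_sphere ⟨fun x ↦ ‖G x‖⁻¹ • G x, ?_, ?_, ?_⟩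
  · exact ((hGc.norm ℝ hG0).inv fun x ↦ norm_ne_zero_iff.2 (hG0 x)).smul hGc
  · intro x _
    rw [norm_smul, norm_inv, norm_norm, inv_mul_cancel₀ (norm_ne_zero_iff.2 (hG0 x))]
  · intro x hx
    simp [hGout x hx.ge, hx]

/-- A continuous map that is uniformly close to the identity on the closed unit ball has a zero
there. -/
theorem ContinuousOn.exists_zero_of_norm_sub_le {F : E → E}
    (hF : ContinuousOn F (closedBall 0 1)) (h : ∀ x, ‖x‖ ≤ 1 → ‖F x - x‖ ≤ 1 / 4) :
    ∃ x, ‖x‖ ≤ 1 ∧ F x = 0 := by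
  by_contra! hne
  have := TietzeExtension.of_tvs ℝ (E := E)
  obtain ⟨F', hF'⟩ := ContinuousMap.exists_restrict_eq isClosed_closedBall
    (⟨_, hF.domRestrict⟩ : C(closedBall (0 : E) 1, E))
  have hFF' : ∀ x, ‖x‖ ≤ 1 → F' x = F x := fun x hx ↦
    congrArg (fun g ↦ g ⟨x, mem_closedBall_zero_iff.2 hx⟩) hF'
  obtain ⟨z, hz, hmin⟩ := (isCompact_closedBall (0 : E) 1).exists_isMinOn
    (nonempty_closedBall.2 zero_le_one) hF.norm
  have hm : 0 < ‖F z‖ := norm_pos_iff.2 (hne z (mem_closedBall_zero_iff.1 hz))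
  obtain ⟨P, hP, hPF, -⟩ := F'.continuous.exists_contDiff_approx 1
    (ε := fun _ ↦ min ‖F z‖ (1 / 4)) continuous_const fun _ ↦ by positivity
  have hclose : ∀ x, ‖x‖ ≤ 1 → ‖P x - F x‖ < min ‖F z‖ (1 / 4) := fun x hx ↦ by
    rw [← hFF' x hx, ← dist_eq_norm]
    exact hPF x
  obtain ⟨x, hx, h0⟩ := ContDiff.exists_zero_of_norm_sub_le (F := P) (mod_cast hP) fun x hx ↦ by
    have h1 := (hclose x hx).trans_le (min_le_right _ _)
    have h2 := norm_sub_le_norm_sub_add_norm_sub (P x) (F x) x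
    linarith [h x hx]
  have h1 := (hclose x hx).trans_le (min_le_left _ _)
  rw [h0, zero_sub, norm_neg] at h1
  exact absurd (hmin (mem_closedBall_zero_iff.2 hx)) (not_le.2 h1)

/-- A continuous injective map on the closed unit ball maps the center to an interior point of the
image. -/
theorem ContinuousOn.mem_interior_image_closedBall {f : E → E}
    (hf : ContinuousOn f (closedBall 0 1)) (hinj : InjOn f (closedBall 0 1)) :
    f 0 ∈ interior (f '' closedBall 0 1) := by
  by_contra hint
  borelize E
  have hB : IsCompact (closedBall (0 : E) 1) := isCompact_closedBall 0 1
  have : CompactSpace (closedBall (0 : E) 1) := isCompact_iff_compactSpace.1 hB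
  have := TietzeExtension.of_tvs ℝ (E := E)
  obtain ⟨G, hG⟩ := ContinuousMap.exists_extension'
    (hf.domRestrict.isClosedEmbedding (injOn_iff_injective.1 hinj))
    (⟨Subtype.val, continuous_subtype_val⟩ : C(closedBall (0 : E) 1, E))
  have hGf : ∀ x, ‖x‖ ≤ 1 → G (f x) = x := fun x hx ↦
    congrFun hG ⟨x, mem_closedBall_zero_iff.2 hx⟩
  obtain ⟨η, hη, hGη⟩ := Metric.continuousAt_iff.1 G.continuous.continuousAt (1 / 10) (by norm_num)
  rw [hGf 0 (by simp)] at hGη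
  simp only [dist_zero_right] at hGη
  obtain ⟨δ, hδ, rfl⟩ : ∃ δ, 0 < δ ∧ 2 * δ = η := ⟨η / 2, by positivity, by ring⟩
  obtain ⟨c, hc, hcK⟩ : ∃ c ∈ ball (f 0) δ, c ∉ f '' closedBall 0 1 := by
    by_contra! hsub
    exact hint (mem_interior.2 ⟨_, hsub, isOpen_ball, mem_ball_self hδ⟩)
  have hGc : ∀ y, dist y c ≤ δ → ‖G y‖ < 1 / 10 := fun y hy ↦ hGη <| by
    linarith [dist_triangle y c (f 0), mem_ball.1 hc]
  obtain ⟨m, hm, hGm⟩ : ∃ m > 0, ∀ y ∈ f '' closedBall 0 1, δ ≤ dist y c → m ≤ ‖G y‖ := by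
    have hS : IsCompact (f '' closedBall 0 1 ∩ {y | δ ≤ dist y c}) :=
      (hB.image_of_continuousOn hf).inter_right
        (isClosed_le continuous_const (continuous_id.dist continuous_const))
    rcases eq_empty_or_nonempty (f '' closedBall 0 1 ∩ {y | δ ≤ dist y c}) with he | he
    · exact ⟨1, one_pos, fun y hy hyc ↦ (he.le ⟨hy, hyc⟩).elim⟩
    obtain ⟨z, ⟨⟨x, hx, rfl⟩, hzc⟩, hmin⟩ := hS.exists_isMinOn he G.continuous.norm.continuousOn
    refine ⟨‖G (f x)‖, norm_pos_iff.2 fun h0 ↦ ?_, fun y hy hyc ↦ hmin ⟨hy, hyc⟩⟩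
    rw [hGf x (mem_closedBall_zero_iff.1 hx)] at h0
    subst h0
    rw [mem_ball, dist_comm] at hc
    exact (not_lt.2 hzc) hc
  set ε : ℝ := min (m / 2) (1 / 100) with hε_def
  have hε : 0 < ε := by positivity
  obtain ⟨P, hP, hPG, -⟩ := G.continuous.exists_contDiff_approx 1
    (ε := fun _ ↦ ε) continuous_const fun _ ↦ hε
  have hPd : Differentiable ℝ P := hP.differentiable (by simp)
  obtain ⟨v, hv, hvP⟩ : ∃ v ∈ ball (0 : E) ε, v ∉ P '' sphere c δ := by
    by_contra! hsub
    have h0 := addHaar_image_eq_zero_of_differentiableOn_of_addHaar_eq_zero volume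
      hPd.differentiableOn (Measure.addHaar_sphere_of_ne_zero volume c hδ.ne')
    exact (measure_ball_pos volume (0 : E) hε).ne' (measure_mono_null hsub h0)
  have hQ : ∀ y, ‖P y - v - G y‖ < 2 * ε := fun y ↦ by
    have h1 := hPG y
    rw [dist_eq_norm] at h1
    have h2 := norm_sub_le (P y - G y) v
    rw [sub_right_comm]
    linarith [mem_ball_zero_iff.1 hv]
  have hε1 : 2 * ε ≤ m := by linarith [min_le_left (m / 2) (1 / 100)]
  have hε2 : 2 * ε ≤ 1 / 50 := by linarith [min_le_right (m / 2) (1 / 100)]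
  set Φ : E → E := fun y ↦ c + max (δ / dist y c) 1 • (y - c) with hΦ
  have hΦ_far : ∀ y, δ ≤ dist y c → Φ y = y := fun y hy ↦ by
    rw [hΦ]
    simp only
    rw [max_eq_right ((div_le_one (hδ.trans_le hy)).2 hy), one_smul, add_sub_cancel]
  have hΦ_near : ∀ y, y ≠ c → dist y c < δ → dist (Φ y) c = δ := fun y hyc hy ↦ by
    have hpos := dist_pos.2 hyc
    rw [hΦ]
    simp only
    rw [max_eq_left ((one_le_div hpos).2 hy.le), dist_eq_norm, add_sub_cancel_left, norm_smul,
      ← dist_eq_norm, Real.norm_of_nonneg (by positivity), div_mul_cancel₀ _ hpos.ne']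
  have hfc : ∀ x ∈ closedBall (0 : E) 1, f x ≠ c := fun x hx h ↦ hcK ⟨x, hx, h⟩
  have hcont : ContinuousOn (fun x ↦ P (Φ (f x)) - v) (closedBall 0 1) := by
    refine (hPd.continuous.comp_continuousOn ?_).sub continuousOn_const
    have hscale : ContinuousOn (fun x ↦ max (δ / dist (f x) c) 1) (closedBall 0 1) :=
      (continuousOn_const.div (continuous_dist.comp_continuousOn (hf.prodMk continuousOn_const))
        fun x hx ↦ (dist_pos.2 (hfc x hx)).ne').sup continuousOn_const
    exact continuousOn_const.add (hscale.smul (hf.sub continuousOn_const))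
  obtain ⟨x, hx, h0⟩ := hcont.exists_zero_of_norm_sub_le fun x hx ↦ by
    have hxG := hGf x hx
    rcases le_or_gt δ (dist (f x) c) with hd | hd
    · rw [hΦ_far _ hd]
      have := hQ (f x)
      rw [hxG] at this
      linarith
    · have hΦd := hΦ_near _ (hfc x (mem_closedBall_zero_iff.2 hx)) hd
      have h1 := hQ (Φ (f x))
      have h2 := hGc _ hΦd.le
      have h3 := hGc _ hd.le
      rw [hxG] at h3
      have h4 := norm_sub_le_norm_sub_add_norm_sub (P (Φ (f x)) - v) (G (Φ (f x))) x
      have h5 := norm_sub_le (G (Φ (f x))) x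
      linarith
  have hxB := mem_closedBall_zero_iff.2 hx
  rcases le_or_gt δ (dist (f x) c) with hd | hd
  · rw [hΦ_far _ hd] at h0
    have h1 := hQ (f x)
    rw [h0, zero_sub, norm_neg] at h1
    linarith [hGm _ ⟨x, hxB, rfl⟩ hd]
  · exact hvP ⟨_, hΦ_near _ (hfc x hxB) hd, sub_eq_zero.1 h0⟩

theorem ContinuousOn.isOpen_image_of_injOn {f : E → E} {U : Set E} (hf : ContinuousOn f U)
    (hU : IsOpen U) (hinj : InjOn f U) : IsOpen (f '' U) := by
  rw [isOpen_iff_mem_nhds]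
  rintro _ ⟨x, hx, rfl⟩
  obtain ⟨ρ, hρ, hsub⟩ := nhds_basis_closedBall.mem_iff.1 (hU.mem_nhds hx)
  have hmaps : MapsTo (fun y ↦ x + ρ • y) (closedBall (0 : E) 1) U := fun y hy ↦ hsub <| by
    rw [mem_closedBall, dist_eq_norm, add_sub_cancel_left, norm_smul, Real.norm_of_nonneg hρ.le]
    exact mul_le_of_le_one_right hρ.le (mem_closedBall_zero_iff.1 hy)
  have hinj' : Function.Injective fun y : E ↦ x + ρ • y :=
    (add_right_injective x).comp (smul_right_injective E hρ.ne')
  have h := ContinuousOn.mem_interior_image_closedBall (f := fun y ↦ f (x + ρ • y))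
    (hf.comp (by fun_prop) hmaps) (hinj.comp hinj'.injOn hmaps)
  simp only [smul_zero, add_zero] at h
  refine Filter.mem_of_superset (mem_interior_iff_mem_nhds.1 h) ?_
  rintro _ ⟨y, hy, rfl⟩
  exact ⟨_, hmaps hy, rfl⟩

end

/-- Invariance of domain: if `U ⊆ ℝⁿ` is open and `f : U → ℝⁿ` is continuous and injective,
then `f(U)` is open and `f` is a homeomorphism onto its image. -/
theorem invariance_of_domain (n : ℕ) (U : Set (EuclideanSpace ℝ (Fin n)))
    (hU : IsOpen U) (f : EuclideanSpace ℝ (Fin n) → EuclideanSpace ℝ (Fin n))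
    (hf : ContinuousOn f U) (hinj : Set.InjOn f U) :
    IsOpen (f '' U) ∧ ∃ h : U ≃ₜ (f '' U), ∀ x : U, (h x : EuclideanSpace ℝ (Fin n)) = f x := by
  refine ⟨hf.isOpen_image_of_injOn hU hinj,
    (Equiv.Set.imageOfInjOn f U hinj).toHomeomorphOfContinuousOpen ?_ ?_, fun _ ↦ rfl⟩
  · exact hf.domRestrict.subtype_mk _
  · intro V hV
    have hV' : IsOpen (f '' (Subtype.val '' V)) :=
      (hf.mono (Subtype.coe_image_subset U V)).isOpen_image_of_injOn
        (hU.isOpenMap_subtype_val V hV) (hinj.mono (Subtype.coe_image_subset U V))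
    convert hV'.preimage continuous_subtype_val
    ext ⟨y, hy⟩
    simp [Equiv.Set.imageOfInjOn, Subtype.ext_iff]
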